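/- Let U be an N×N unitary matrix with orthonormal eigenbasis {χ_j}_{j=0}^{N−1} and eigenphases τ_j ∈ ℝ (so Uχ_j = e^{iτ_j}χ_j). Let F(x) = Σ_{j=−L}^{L} c_j e^{ijx} be a trigonometric polynomial with |F(x)| ≤ 1 for all x ∈ ℝ. Then there exist ω ∈ ℝ and θ, φ ∈ ℝ^{2L+1} such that the upper-left N×N block of the QPP circuit, (e_0† ⊗ I_N)·V^{2L}_{ω,θ,φ}(U)·(e_0 ⊗ I_N), equals F(U) := Σ_{j=0}^{N−1} F(τ_j)·χ_j χ_j†. -/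

import Mathlib

open scoped Matrix

/-- `R_z(φ) = diag(e^{-iφ/2}, e^{iφ/2})`. -/
noncomputable def Rz (φ : ℝ) : Matrix (Fin 2) (Fin 2) ℂ :=
  !![Complex.exp (-(Complex.I * φ / 2)), 0; 0, Complex.exp (Complex.I * φ / 2)]

/-- `R_y(θ)`, the real rotation by angle `θ/2`, viewed as a complex matrix. -/
noncomputable def Ry (θ : ℝ) : Matrix (Fin 2) (Fin 2) ℂ :=
  !![(Real.cos (θ / 2) : ℂ), -(Real.sin (θ / 2) : ℂ);
     (Real.sin (θ / 2) : ℂ), (Real.cos (θ / 2) : ℂ)]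

/-- The trigonometric QSP unitary
`W^L_{ω,θ,φ}(x) = R_z(ω) R_y(θ_0) R_z(φ_0) ∏_{l=1}^{L} [R_z(x) R_y(θ_l) R_z(φ_l)]`,
multiplied left to right in increasing `l`. -/
noncomputable def Wqsp (L : ℕ) (ω : ℝ) (θ φ : ℕ → ℝ) (x : ℝ) :
    Matrix (Fin 2) (Fin 2) ℂ :=
  Rz ω * Ry (θ 0) * Rz (φ 0) *
    ((List.range L).map (fun l => Rz x * Ry (θ (l + 1)) * Rz (φ (l + 1)))).prod

open scoped Kronecker

/-- Block-diagonal matrix `B(X,Y)` with upper-left block `X` and lower-right block `Y`,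
as a matrix on `ℂ² ⊗ ℂⁿ`. -/
noncomputable def blockDiag2 {n : Type*} [Fintype n] [DecidableEq n]
    (X Y : Matrix n n ℂ) : Matrix (Fin 2 × n) (Fin 2 × n) ℂ :=
  (!![1, 0; 0, 0] : Matrix (Fin 2) (Fin 2) ℂ) ⊗ₖ X +
    (!![0, 0; 0, 1] : Matrix (Fin 2) (Fin 2) ℂ) ⊗ₖ Y

/-- The QPP circuit for an even number `2·halfL` of layers. -/
noncomputable def qppEven {n : Type*} [Fintype n] [DecidableEq n]
    (U : Matrix n n ℂ) (halfL : ℕ) (ω : ℝ) (θ φ : ℕ → ℝ) :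
    Matrix (Fin 2 × n) (Fin 2 × n) ℂ :=
  ((Rz ω * Ry (θ 0) * Rz (φ 0)) ⊗ₖ (1 : Matrix n n ℂ)) *
    ((List.range halfL).map (fun l =>
      blockDiag2 Uᴴ 1 *
        ((Ry (θ (2 * l + 1)) * Rz (φ (2 * l + 1))) ⊗ₖ (1 : Matrix n n ℂ)) *
        blockDiag2 1 U *
        ((Ry (θ (2 * l + 2)) * Rz (φ (2 * l + 2))) ⊗ₖ (1 : Matrix n n ℂ)))).prod

/-- The quantum phase processing (QPP) circuit `V^L_{ω,θ,φ}(U)`: for even `L` it is the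
interleaved product of ancilla rotations and controlled-`U†`, controlled-`U`; for odd `L`
one extra layer `B(U†, I)·(R_y(θ_L) R_z(φ_L) ⊗ I)` is appended. -/
noncomputable def qpp {n : Type*} [Fintype n] [DecidableEq n]
    (U : Matrix n n ℂ) (L : ℕ) (ω : ℝ) (θ φ : ℕ → ℝ) :
    Matrix (Fin 2 × n) (Fin 2 × n) ℂ :=
  if L % 2 = 0 then qppEven U (L / 2) ω θ φ
  else qppEven U (L / 2) ω θ φ * blockDiag2 Uᴴ 1 *
    ((Ry (θ L) * Rz (φ L)) ⊗ₖ (1 : Matrix n n ℂ))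

section

open Polynomial

/-- The conjugate reciprocal `z ↦ z ^ n * conj (p (1 / conj z))` of a polynomial `p`. -/
noncomputable def conjReflect (n : ℕ) (p : ℂ[X]) : ℂ[X] :=
  (p.map (starRingEnd ℂ)).reflect n

theorem eval_conjReflect {n : ℕ} {p : ℂ[X]} (hp : p.natDegree ≤ n) {z : ℂ} (hz : z ≠ 0) :
    (conjReflect n p).eval z = z ^ n * (starRingEnd ℂ) (p.eval ((starRingEnd ℂ) z)⁻¹) := by
  have hz' : z⁻¹ ≠ 0 := inv_ne_zero hz
  let := invertibleOfNonzero hz'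
  have h := eval₂_reflect_mul_pow (RingHom.id ℂ) z⁻¹ n (p.map (starRingEnd ℂ))
    ((natDegree_map_le).trans hp)
  rw [invOf_eq_inv, inv_inv] at h
  change eval z (conjReflect n p) * _ = eval z⁻¹ (p.map (starRingEnd ℂ)) at h
  have h2 : eval z⁻¹ (p.map (starRingEnd ℂ)) =
      (starRingEnd ℂ) (p.eval ((starRingEnd ℂ) z)⁻¹) := by
    rw [← map_inv₀, ← eval_map_apply, Complex.conj_conj]
  rw [← h2, ← h, inv_pow]
  field_simp

theorem mul_conj_of_norm_eq_one {z : ℂ} (hz : ‖z‖ = 1) : z * (starRingEnd ℂ) z = 1 := by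
  rw [Complex.mul_conj']; simp [hz]

theorem inv_conj_of_norm_eq_one {z : ℂ} (hz : ‖z‖ = 1) : ((starRingEnd ℂ) z)⁻¹ = z :=
  inv_eq_of_mul_eq_one_left (mul_conj_of_norm_eq_one hz)

theorem eval_conjReflect_of_norm_eq_one {n : ℕ} {p : ℂ[X]} (hp : p.natDegree ≤ n) {z : ℂ}
    (hz : ‖z‖ = 1) : (conjReflect n p).eval z = z ^ n * (starRingEnd ℂ) (p.eval z) := by
  rw [eval_conjReflect hp (by rintro rfl; simp at hz), inv_conj_of_norm_eq_one hz]

theorem natDegree_conjReflect_le {n : ℕ} {p : ℂ[X]} (hp : p.natDegree ≤ n) :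
    (conjReflect n p).natDegree ≤ n := by
  refine (natDegree_reflect_le).trans ?_
  exact max_le le_rfl (natDegree_map_le.trans hp)

theorem coeff_conjReflect (n : ℕ) (p : ℂ[X]) {i : ℕ} (hi : i ≤ n) :
    (conjReflect n p).coeff i = (starRingEnd ℂ) (p.coeff (n - i)) := by
  simp [conjReflect, coeff_reflect, revAt_le hi]

theorem infinite_norm_eq_one : {z : ℂ | ‖z‖ = 1}.Infinite := by
  have hlt : -Real.pi < Real.pi := by linarith [Real.pi_pos]
  have : Infinite (Set.Ioc (-Real.pi) Real.pi) := (Set.Ioc_infinite hlt).to_subtype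
  have : Infinite Circle := Circle.argEquiv.infinite_iff.mpr this
  have h := Set.infinite_range_of_injective (f := fun z : Circle => (z : ℂ)) Circle.coe_injective
  refine h.mono ?_
  rintro _ ⟨z, rfl⟩
  exact Circle.norm_coe z

theorem eq_of_eval_eq_of_norm_eq_one {p q : ℂ[X]}
    (h : ∀ z : ℂ, ‖z‖ = 1 → p.eval z = q.eval z) : p = q :=
  eq_of_infinite_eval_eq p q (infinite_norm_eq_one.mono h)


open scoped ComplexOrder in
/-- `p` is `z ^ m` times a nonnegative function on the unit circle. -/
def NonnegOnCircle (m : ℕ) (p : ℂ[X]) : Prop :=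
  ∀ z : ℂ, ‖z‖ = 1 → 0 ≤ p.eval z * (starRingEnd ℂ) z ^ m

theorem NonnegOnCircle.conjReflect_eq {m : ℕ} {p : ℂ[X]} (h : NonnegOnCircle m p)
    (hp : p.natDegree ≤ 2 * m) : conjReflect (2 * m) p = p := by
  refine eq_of_eval_eq_of_norm_eq_one fun z hz => ?_
  rw [eval_conjReflect_of_norm_eq_one hp hz]
  have h1 : (starRingEnd ℂ) (p.eval z * (starRingEnd ℂ) z ^ m) =
      p.eval z * (starRingEnd ℂ) z ^ m :=
    Complex.conj_eq_iff_im.mpr (Complex.nonneg_iff.mp (h z hz)).2.symm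
  have h2 : z ^ m * (starRingEnd ℂ) z ^ m = 1 := by
    rw [← mul_pow, mul_conj_of_norm_eq_one hz, one_pow]
  rw [map_mul, map_pow, Complex.conj_conj] at h1
  rw [two_mul, pow_add]
  linear_combination z ^ m * h1 + eval z p * h2

theorem norm_exp_mul_of_norm_eq_one {a : ℂ} (ha : ‖a‖ = 1) (x : ℝ) :
    ‖a * Complex.exp (x * Complex.I)‖ = 1 := by
  rw [norm_mul, ha, Complex.norm_exp_ofReal_mul_I, one_mul]

theorem hasDerivAt_mul_exp_mul_I (a : ℂ) :
    HasDerivAt (fun x : ℝ => a * Complex.exp (x * Complex.I)) (a * Complex.I) 0 := by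
  have h1 : HasDerivAt (fun x : ℝ => (x : ℂ) * Complex.I) (1 * Complex.I) 0 :=
    (Complex.ofRealCLM.hasDerivAt (x := (0 : ℝ))).mul_const _
  simpa using (h1.cexp).const_mul a

theorem NonnegOnCircle.derivative_eval_eq_zero {m : ℕ} {p : ℂ[X]} (h : NonnegOnCircle m p)
    {a : ℂ} (ha : ‖a‖ = 1) (hpa : p.eval a = 0) : p.derivative.eval a = 0 := by
  set γ : ℝ → ℂ := fun x => a * Complex.exp (x * Complex.I) with hγ
  have hγ0 : γ 0 = a := by simp [hγ]
  have dγ : HasDerivAt γ (a * Complex.I) 0 := hasDerivAt_mul_exp_mul_I a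
  have dp : HasDerivAt (fun x => p.eval (γ x)) (p.derivative.eval a * (a * Complex.I)) 0 := by
    have := (p.hasDerivAt (γ 0)).comp (0 : ℝ) dγ
    rwa [hγ0] at this
  have dc : HasDerivAt (fun x => (starRingEnd ℂ) (γ x))
      ((starRingEnd ℂ) (a * Complex.I)) 0 :=
    Complex.conjCLE.toContinuousLinearMap.hasFDerivAt.comp_hasDerivAt (0 : ℝ) dγ
  have dG := dp.mul (dc.pow m)
  simp only [hγ0, hpa, zero_mul, add_zero, Pi.pow_apply] at dG
  set w := p.derivative.eval a * (a * Complex.I) * (starRingEnd ℂ) a ^ m with hw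
  have hG : ∀ x, 0 ≤ (p.eval (γ x) * (starRingEnd ℂ) (γ x) ^ m).re ∧
      0 = (p.eval (γ x) * (starRingEnd ℂ) (γ x) ^ m).im := fun x =>
    Complex.nonneg_iff.mp (h _ (norm_exp_mul_of_norm_eq_one ha x))
  have hre : w.re = 0 := by
    refine IsLocalMin.hasDerivAt_eq_zero
      (f := fun x => (p.eval (γ x) * (starRingEnd ℂ) (γ x) ^ m).re)
      (Filter.Eventually.of_forall fun x => ?_)
      (Complex.reCLM.hasFDerivAt.comp_hasDerivAt (0 : ℝ) dG)
    simpa [hγ0, hpa] using (hG x).1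
  have him : w.im = 0 := by
    refine IsLocalMin.hasDerivAt_eq_zero
      (f := fun x => (p.eval (γ x) * (starRingEnd ℂ) (γ x) ^ m).im)
      (Filter.Eventually.of_forall fun x => ?_)
      (Complex.imCLM.hasFDerivAt.comp_hasDerivAt (0 : ℝ) dG)
    simpa [hγ0, hpa] using (hG x).2.le
  have hw0 : w = 0 := Complex.ext hre him
  have ha0 : a ≠ 0 := by rintro rfl; simp at ha
  simpa [hw, ha0] using hw0

theorem NonnegOnCircle.of_mul {m : ℕ} {k : ℂ[X]} {a : ℂ}
    (h : NonnegOnCircle (m + 1) ((X - C a) * (1 - C ((starRingEnd ℂ) a) * X) * k)) :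
    NonnegOnCircle m k := by
  have hne : ∀ z : ℂ, ‖z‖ = 1 → z ≠ a → k.eval z * (starRingEnd ℂ) z ^ m ∈
      {w : ℂ | 0 ≤ w.re ∧ 0 = w.im} := by
    intro z hz hza
    have h1 := h z hz
    have h2 : eval z ((X - C a) * (1 - C ((starRingEnd ℂ) a) * X) * k) *
        (starRingEnd ℂ) z ^ (m + 1) =
        ((Complex.normSq (z - a) : ℝ) : ℂ) * (k.eval z * (starRingEnd ℂ) z ^ m) := by
      rw [← Complex.mul_conj]
      simp only [eval_mul, eval_sub, eval_X, eval_C, eval_one, map_sub]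
      linear_combination (-(z - a) * (starRingEnd ℂ) a * (k.eval z * (starRingEnd ℂ) z ^ m)) *
        mul_conj_of_norm_eq_one hz
    rw [h2, Complex.nonneg_iff, Complex.re_ofReal_mul, Complex.im_ofReal_mul] at h1
    have hpos : 0 < Complex.normSq (z - a) := Complex.normSq_pos.mpr (sub_ne_zero.mpr hza)
    refine ⟨nonneg_of_mul_nonneg_right h1.1 hpos, ?_⟩
    exact ((mul_eq_zero.mp h1.2.symm).resolve_left hpos.ne').symm
  intro z hz
  rw [Complex.nonneg_iff]
  by_cases hza : z = a
  · have hcl : IsClosed {w : ℂ | 0 ≤ w.re ∧ 0 = w.im} :=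
      (isClosed_le continuous_const Complex.continuous_re).inter
        (isClosed_eq continuous_const Complex.continuous_im)
    set γ : ℝ → ℂ := fun x => z * Complex.exp (x * Complex.I) with hγ
    have hγ0 : γ 0 = z := by simp [hγ]
    have dγ : HasDerivAt γ (z * Complex.I) 0 := hasDerivAt_mul_exp_mul_I z
    have hz0 : z ≠ 0 := by rintro rfl; simp at hz
    have hev := dγ.eventually_ne (c := a) (mul_ne_zero hz0 Complex.I_ne_zero)
    have hcont : Continuous fun x => k.eval (γ x) * (starRingEnd ℂ) (γ x) ^ m := by
      have : Continuous γ := by fun_prop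
      have h2 : Continuous fun x => (starRingEnd ℂ) (γ x) := Complex.continuous_conj.comp this
      exact (k.continuous.comp this).mul (h2.pow m)
    have ht := (hcont.tendsto 0).mono_left (nhdsWithin_le_nhds (s := {0}ᶜ))
    rw [hγ0] at ht
    exact hcl.mem_of_tendsto ht
      (hev.mono fun x hx => hne _ (norm_exp_mul_of_norm_eq_one hz x) hx)
  · exact hne z hz hza

theorem NonnegOnCircle.exists_factor {m : ℕ} {p : ℂ[X]} (h : NonnegOnCircle m p)
    (hp : p.natDegree ≤ 2 * m) {a : ℂ} (ha0 : a ≠ 0) (ha : p.eval a = 0) :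
    ∃ k : ℂ[X], p = (X - C a) * (1 - C ((starRingEnd ℂ) a) * X) * k := by
  obtain ⟨k, hk⟩ := dvd_iff_isRoot.mpr (show p.IsRoot a from ha)
  have hca : (starRingEnd ℂ) a ≠ 0 := by simpa using ha0
  have hroot : k.eval ((starRingEnd ℂ) a)⁻¹ = 0 := by
    by_cases hn : ‖a‖ = 1
    · rw [inv_conj_of_norm_eq_one hn]
      have := h.derivative_eval_eq_zero hn ha
      simpa [hk] using this
    · have h1 := eval_conjReflect hp ha0
      rw [h.conjReflect_eq hp, ha] at h1
      have h2 : p.eval ((starRingEnd ℂ) a)⁻¹ = 0 := by simpa [ha0] using h1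
      rw [hk, eval_mul, mul_eq_zero] at h2
      refine h2.resolve_left fun h3 => hn ?_
      have h4 : ((starRingEnd ℂ) a)⁻¹ = a := by simpa [sub_eq_zero] using h3
      have h5 : (starRingEnd ℂ) a * a = 1 := by
        nth_rewrite 2 [← h4]
        exact mul_inv_cancel₀ hca
      have h6 := congrArg norm h5
      rw [norm_mul, RCLike.norm_conj, norm_one] at h6
      nlinarith [norm_nonneg a]
  obtain ⟨k', hk'⟩ := dvd_iff_isRoot.mpr (show k.IsRoot _ from hroot)
  refine ⟨C (-((starRingEnd ℂ) a)⁻¹) * k', ?_⟩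
  have h7 : C ((starRingEnd ℂ) a) * C ((starRingEnd ℂ) a)⁻¹ = (1 : ℂ[X]) := by
    rw [← C_mul, mul_inv_cancel₀ hca, C_1]
  rw [hk, hk', C_neg]
  linear_combination (-(X - C a) * X * k') * h7

/-- **Fejér–Riesz theorem**: a nonnegative trigonometric polynomial is the squared modulus
of a polynomial on the unit circle. -/
theorem NonnegOnCircle.exists_eval_eq_normSq : ∀ (m : ℕ) {p : ℂ[X]}, NonnegOnCircle m p →
    p.natDegree ≤ 2 * m → ∃ g : ℂ[X], g.natDegree ≤ m ∧ ∀ z : ℂ, ‖z‖ = 1 →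
      p.eval z * (starRingEnd ℂ) z ^ m = g.eval z * (starRingEnd ℂ) (g.eval z)
  | 0, p, h, hp => by
    obtain ⟨c, rfl⟩ : ∃ c, p = C c := ⟨_, eq_C_of_natDegree_le_zero (by simpa using hp)⟩
    have h1 : 0 ≤ c.re ∧ 0 = c.im := by simpa [Complex.nonneg_iff] using h 1 (by simp)
    refine ⟨C ((Real.sqrt c.re : ℝ) : ℂ), by simp, fun z _ => ?_⟩
    simp only [eval_C, pow_zero, mul_one, Complex.conj_ofReal]
    rw [← Complex.ofReal_mul, Real.mul_self_sqrt h1.1]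
    exact Complex.ext (by simp) (by simp [← h1.2])
  | m + 1, p, h, hp => by
    by_cases h0 : p.coeff 0 = 0
    · have hX := divX_mul_X_add p
      rw [h0, C_0, add_zero] at hX
      have htop : p.coeff (2 * (m + 1)) = 0 := by
        rw [← h.conjReflect_eq hp, coeff_conjReflect _ _ le_rfl]
        simp [h0]
      have hdeg : p.divX.natDegree ≤ 2 * m := by
        rw [natDegree_le_iff_coeff_eq_zero]
        intro N hN
        rw [coeff_divX]
        rcases eq_or_lt_of_le (show 2 * (m + 1) ≤ N + 1 by omega) with h1 | h1
        · rw [← h1, htop]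
        · exact coeff_eq_zero_of_natDegree_lt (by omega)
      have hev : ∀ z : ℂ, ‖z‖ = 1 → p.eval z * (starRingEnd ℂ) z ^ (m + 1) =
          p.divX.eval z * (starRingEnd ℂ) z ^ m := by
        intro z hz
        conv_lhs => rw [← hX]
        rw [eval_mul, eval_X]
        linear_combination (p.divX.eval z * (starRingEnd ℂ) z ^ m) * mul_conj_of_norm_eq_one hz
      obtain ⟨g, hg, hgz⟩ := NonnegOnCircle.exists_eval_eq_normSq m (p := p.divX)
        (fun z hz => hev z hz ▸ h z hz) hdeg
      exact ⟨g, by omega, fun z hz => (hev z hz).trans (hgz z hz)⟩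
    · have htop : p.coeff (2 * (m + 1)) ≠ 0 := by
        rw [← h.conjReflect_eq hp, coeff_conjReflect _ _ le_rfl]
        simpa using h0
      have hp0 : p ≠ 0 := by rintro rfl; simp at h0
      have hdeg : 0 < p.degree := by
        rw [← natDegree_pos_iff_degree_pos]
        have := le_natDegree_of_ne_zero htop
        omega
      obtain ⟨a, ha⟩ := Complex.exists_root hdeg
      have ha0 : a ≠ 0 := by
        rintro rfl
        exact h0 (by simpa [coeff_zero_eq_eval_zero] using ha)
      obtain ⟨k, hk⟩ := h.exists_factor hp ha0 ha
      have hlin : natDegree (1 - C ((starRingEnd ℂ) a) * X) = 1 := by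
        have : (1 - C ((starRingEnd ℂ) a) * X : ℂ[X]) = C (-(starRingEnd ℂ) a) * X + C 1 := by
          simp only [C_neg, C_1]; ring
        rw [this]
        exact natDegree_linear (by simpa using ha0)
      have hkdeg : k.natDegree ≤ 2 * m := by
        have h1 : ((X - C a) * (1 - C ((starRingEnd ℂ) a) * X)) ≠ 0 ∧ k ≠ 0 := by
          rw [hk] at hp0
          exact ⟨left_ne_zero_of_mul hp0, right_ne_zero_of_mul hp0⟩
        have h2 := natDegree_mul h1.1 h1.2
        rw [natDegree_mul (left_ne_zero_of_mul h1.1) (right_ne_zero_of_mul h1.1), hlin,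
          natDegree_X_sub_C, ← hk] at h2
        omega
      obtain ⟨g, hg, hgz⟩ := NonnegOnCircle.exists_eval_eq_normSq m
        (NonnegOnCircle.of_mul (hk ▸ h)) hkdeg
      refine ⟨(X - C a) * g, ?_, fun z hz => ?_⟩
      · refine natDegree_mul_le.trans ?_
        rw [natDegree_X_sub_C]
        omega
      · rw [hk]
        simp only [eval_mul, eval_sub, eval_X, eval_C, eval_one, map_sub, map_mul]
        linear_combination ((z - a) * ((starRingEnd ℂ) z - (starRingEnd ℂ) a)) * hgz z hz -
          ((z - a) * (starRingEnd ℂ) a * (k.eval z * (starRingEnd ℂ) z ^ m)) *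
          mul_conj_of_norm_eq_one hz

/-- A polynomial bounded by one on the unit circle is the first entry of a normalized pair. -/
theorem exists_completion {n : ℕ} {p : ℂ[X]} (hp : p.natDegree ≤ n)
    (hbound : ∀ z : ℂ, ‖z‖ = 1 → ‖p.eval z‖ ≤ 1) :
    ∃ q : ℂ[X], q.natDegree ≤ n ∧ ∀ z : ℂ, ‖z‖ = 1 →
      p.eval z * (starRingEnd ℂ) (p.eval z) + q.eval z * (starRingEnd ℂ) (q.eval z) = 1 := by
  have hev : ∀ z : ℂ, ‖z‖ = 1 → (X ^ n - p * conjReflect n p).eval z * (starRingEnd ℂ) z ^ n =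
      1 - p.eval z * (starRingEnd ℂ) (p.eval z) := by
    intro z hz
    have h2 : z ^ n * (starRingEnd ℂ) z ^ n = 1 := by
      rw [← mul_pow, mul_conj_of_norm_eq_one hz, one_pow]
    simp only [eval_sub, eval_pow, eval_X, eval_mul, eval_conjReflect_of_norm_eq_one hp hz]
    linear_combination (1 - p.eval z * (starRingEnd ℂ) (p.eval z)) * h2
  have hnn : NonnegOnCircle n (X ^ n - p * conjReflect n p) := by
    intro z hz
    rw [hev z hz, Complex.mul_conj', ← Complex.ofReal_pow, ← Complex.ofReal_one,
      ← Complex.ofReal_sub, Complex.nonneg_iff]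
    refine ⟨?_, (Complex.ofReal_im _).symm⟩
    rw [Complex.ofReal_re]
    nlinarith [hbound z hz, norm_nonneg (p.eval z)]
  have hdeg : (X ^ n - p * conjReflect n p).natDegree ≤ 2 * n := by
    refine (natDegree_sub_le _ _).trans (max_le ?_ (natDegree_mul_le.trans ?_))
    · rw [natDegree_X_pow]; omega
    · have := natDegree_conjReflect_le hp
      omega
  obtain ⟨q, hq, hqz⟩ := hnn.exists_eval_eq_normSq n hdeg
  refine ⟨q, hq, fun z hz => ?_⟩
  rw [← hqz z hz, hev z hz]
  ring

theorem coeff_mul_conj_coeff_add_eq_zero {n : ℕ} {p q : ℂ[X]} (hp : p.natDegree ≤ n + 1)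
    (hq : q.natDegree ≤ n + 1)
    (h : ∀ z : ℂ, ‖z‖ = 1 →
      p.eval z * (starRingEnd ℂ) (p.eval z) + q.eval z * (starRingEnd ℂ) (q.eval z) = 1) :
    p.coeff (n + 1) * (starRingEnd ℂ) (p.coeff 0) +
      q.coeff (n + 1) * (starRingEnd ℂ) (q.coeff 0) = 0 := by
  have heq : p * conjReflect (n + 1) p + q * conjReflect (n + 1) q = X ^ (n + 1) := by
    refine eq_of_eval_eq_of_norm_eq_one fun z hz => ?_
    simp only [eval_add, eval_pow, eval_X, eval_mul, eval_conjReflect_of_norm_eq_one hp hz,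
      eval_conjReflect_of_norm_eq_one hq hz]
    linear_combination z ^ (n + 1) * h z hz
  have hc := congrArg (fun r => r.coeff ((n + 1) + (n + 1))) heq
  simp only [coeff_add] at hc
  rw [coeff_mul_add_eq_of_natDegree_le hp (natDegree_conjReflect_le hp),
    coeff_mul_add_eq_of_natDegree_le hq (natDegree_conjReflect_le hq),
    coeff_conjReflect _ _ le_rfl, coeff_conjReflect _ _ le_rfl, Nat.sub_self, coeff_X_pow,
    if_neg (by omega)] at hc
  exact hc

/-- Every vector of `ℂ²` is a multiple of the first row of some `R_y(θ) R_z(φ)`. -/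
theorem exists_angles (a b : ℂ) : ∃ θ φ α : ℝ,
    a = (Real.sqrt (‖a‖ ^ 2 + ‖b‖ ^ 2) : ℝ) * Complex.exp (Complex.I * α) *
      ((Real.cos (θ / 2) : ℂ) * Complex.exp (-(Complex.I * φ / 2))) ∧
    b = (Real.sqrt (‖a‖ ^ 2 + ‖b‖ ^ 2) : ℝ) * Complex.exp (Complex.I * α) *
      (-(Real.sin (θ / 2) : ℂ) * Complex.exp (Complex.I * φ / 2)) := by
  set w : ℂ := ⟨‖a‖, ‖b‖⟩ with hw
  have hwn : ‖w‖ = Real.sqrt (‖a‖ ^ 2 + ‖b‖ ^ 2) := by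
    rw [Complex.norm_def, Complex.normSq_apply, hw]; simp only [sq]
  rw [← hwn]
  refine ⟨-2 * w.arg, b.arg - a.arg, (a.arg + b.arg) / 2, ?_, ?_⟩
  · have h1 := Complex.norm_mul_cos_arg w
    have h2 : ‖w‖ * Real.cos (-2 * w.arg / 2) = ‖a‖ := by
      rw [show -2 * w.arg / 2 = -w.arg by ring, Real.cos_neg]; exact h1
    calc a = ‖a‖ * Complex.exp (a.arg * Complex.I) := (Complex.norm_mul_exp_arg_mul_I a).symm
      _ = _ := by
        rw [← h2, Complex.ofReal_mul]
        have : Complex.exp (a.arg * Complex.I) =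
            Complex.exp (Complex.I * ((a.arg + b.arg) / 2 : ℝ)) *
            Complex.exp (-(Complex.I * (b.arg - a.arg : ℝ) / 2)) := by
          rw [← Complex.exp_add]; congr 1; push_cast; ring
        rw [this]; ring
  · have h1 := Complex.norm_mul_sin_arg w
    have h2 : ‖w‖ * -Real.sin (-2 * w.arg / 2) = ‖b‖ := by
      rw [show -2 * w.arg / 2 = -w.arg by ring, Real.sin_neg, neg_neg]; exact h1
    calc b = ‖b‖ * Complex.exp (b.arg * Complex.I) := (Complex.norm_mul_exp_arg_mul_I b).symm
      _ = _ := by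
        rw [← h2, Complex.ofReal_mul]
        have : Complex.exp (b.arg * Complex.I) =
            Complex.exp (Complex.I * ((a.arg + b.arg) / 2 : ℝ)) *
            Complex.exp (Complex.I * (b.arg - a.arg : ℝ) / 2) := by
          rw [← Complex.exp_add]; congr 1; push_cast; ring
        rw [this]; push_cast; ring

theorem conj_exp_I_mul (x : ℝ) :
    (starRingEnd ℂ) (Complex.exp (Complex.I * x / 2)) = Complex.exp (-(Complex.I * x / 2)) := by
  rw [← Complex.exp_conj]; congr 1; simp [map_ofNat]; ring

theorem exp_mul_exp_neg_eq_one (z : ℂ) : Complex.exp z * Complex.exp (-z) = 1 := by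
  rw [← Complex.exp_add, add_neg_cancel, Complex.exp_zero]

/-- The inverse of `R_y(θ) R_z(φ)` can align a nonzero vector with the first axis, and then any
orthogonal vector with the second one. -/
theorem exists_angles_of_orthogonal_of_ne {a b : ℂ} (hab : a ≠ 0 ∨ b ≠ 0) : ∃ θ φ : ℝ,
    a * ((Real.sin (θ / 2) : ℂ) * Complex.exp (Complex.I * φ / 2)) +
      b * ((Real.cos (θ / 2) : ℂ) * Complex.exp (-(Complex.I * φ / 2))) = 0 ∧
    ∀ c d : ℂ, c * (starRingEnd ℂ) a + d * (starRingEnd ℂ) b = 0 →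
    c * ((Real.cos (θ / 2) : ℂ) * Complex.exp (Complex.I * φ / 2)) -
      d * ((Real.sin (θ / 2) : ℂ) * Complex.exp (-(Complex.I * φ / 2))) = 0 := by
  obtain ⟨θ, φ, α, ha, hb⟩ := exists_angles a b
  set s := (Real.sqrt (‖a‖ ^ 2 + ‖b‖ ^ 2) : ℂ) * Complex.exp (Complex.I * α) with hs
  refine ⟨θ, φ, ?_, fun c d hcd => ?_⟩
  · rw [ha, hb]; ring
  · have hs0 : s ≠ 0 := by
      intro h0
      rw [h0, zero_mul] at ha hb
      tauto
    have hca := congrArg (starRingEnd ℂ) ha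
    have hcb := congrArg (starRingEnd ℂ) hb
    simp only [map_mul, map_neg, Complex.conj_ofReal, ← conj_exp_I_mul, Complex.conj_conj]
      at hca hcb
    rw [conj_exp_I_mul] at hcb
    have hs1 : (starRingEnd ℂ) s ≠ 0 := by simpa using hs0
    refine (mul_eq_zero.mp ?_).resolve_left hs1
    linear_combination hcd - c * hca - d * hcb

theorem exists_angles_of_orthogonal {a b c d : ℂ}
    (h : c * (starRingEnd ℂ) a + d * (starRingEnd ℂ) b = 0) : ∃ θ φ : ℝ,
    a * ((Real.sin (θ / 2) : ℂ) * Complex.exp (Complex.I * φ / 2)) +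
      b * ((Real.cos (θ / 2) : ℂ) * Complex.exp (-(Complex.I * φ / 2))) = 0 ∧
    c * ((Real.cos (θ / 2) : ℂ) * Complex.exp (Complex.I * φ / 2)) -
      d * ((Real.sin (θ / 2) : ℂ) * Complex.exp (-(Complex.I * φ / 2))) = 0 := by
  by_cases hab : a ≠ 0 ∨ b ≠ 0
  · obtain ⟨θ, φ, h1, h2⟩ := exists_angles_of_orthogonal_of_ne hab
    exact ⟨θ, φ, h1, h2 c d h⟩
  push Not at hab
  obtain ⟨rfl, rfl⟩ := hab
  by_cases hcd : c ≠ 0 ∨ d ≠ 0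
  · obtain ⟨θ, φ, -, h2⟩ := exists_angles_of_orthogonal_of_ne
      (a := (starRingEnd ℂ) d) (b := -(starRingEnd ℂ) c) (by simpa using hcd.symm)
    exact ⟨θ, φ, by simp, h2 c d (by simp; ring)⟩
  · push Not at hcd
    exact ⟨0, 0, by simp, by simp [hcd.1, hcd.2]⟩

theorem Wqsp_succ (L : ℕ) (ω : ℝ) (θ φ : ℕ → ℝ) (x : ℝ) :
    Wqsp (L + 1) ω θ φ x = Wqsp L ω θ φ x * (Rz x * Ry (θ (L + 1)) * Rz (φ (L + 1))) := by
  simp [Wqsp, List.range_succ, Matrix.mul_assoc]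

theorem Wqsp_congr {L : ℕ} {ω : ℝ} {θ θ' φ φ' : ℕ → ℝ} (hθ : ∀ l ≤ L, θ l = θ' l)
    (hφ : ∀ l ≤ L, φ l = φ' l) (x : ℝ) : Wqsp L ω θ φ x = Wqsp L ω θ' φ' x := by
  induction L with
  | zero => simp [Wqsp, hθ 0 le_rfl, hφ 0 le_rfl]
  | succ L ih =>
    rw [Wqsp_succ, Wqsp_succ, ih (fun l hl => hθ l (by omega)) (fun l hl => hφ l (by omega)),
      hθ _ le_rfl, hφ _ le_rfl]

/-- Every normalized pair of polynomials is the first row of a QSP unitary. -/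
theorem exists_Wqsp_eq : ∀ (n : ℕ) {p q : ℂ[X]}, p.natDegree ≤ n → q.natDegree ≤ n →
    (∀ z : ℂ, ‖z‖ = 1 →
      p.eval z * (starRingEnd ℂ) (p.eval z) + q.eval z * (starRingEnd ℂ) (q.eval z) = 1) →
    ∃ (ω : ℝ) (θ φ : ℕ → ℝ), ∀ x : ℝ,
      Wqsp n ω θ φ x 0 0 =
        Complex.exp (-(Complex.I * x / 2)) ^ n * p.eval (Complex.exp (Complex.I * x)) ∧
      Wqsp n ω θ φ x 0 1 =
        Complex.exp (-(Complex.I * x / 2)) ^ n * q.eval (Complex.exp (Complex.I * x))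
  | 0, p, q, hp, hq, h => by
    obtain ⟨a, rfl⟩ : ∃ c, p = C c := ⟨_, eq_C_of_natDegree_le_zero hp⟩
    obtain ⟨b, rfl⟩ : ∃ c, q = C c := ⟨_, eq_C_of_natDegree_le_zero hq⟩
    have h1 := h 1 (by simp)
    simp only [eval_C, Complex.mul_conj'] at h1
    have h2 : ‖a‖ ^ 2 + ‖b‖ ^ 2 = 1 := by exact_mod_cast h1
    obtain ⟨θ, φ, α, ha, hb⟩ := exists_angles a b
    rw [h2] at ha hb
    have hα : -(Complex.I * ((-2 * α : ℝ) : ℂ) / 2) = Complex.I * α := by push_cast; ring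
    refine ⟨-2 * α, fun _ => θ, fun _ => φ, fun x => ⟨?_, ?_⟩⟩
    · rw [eval_C, ha]
      simp only [Wqsp, Rz, Ry, hα, List.range_zero, List.map_nil, List.prod_nil, mul_one]
      simp [Matrix.mul_apply, Fin.sum_univ_two]
      ring
    · rw [eval_C, hb]
      simp only [Wqsp, Rz, Ry, hα, List.range_zero, List.map_nil, List.prod_nil, mul_one]
      simp [Matrix.mul_apply, Fin.sum_univ_two]
      ring
  | n + 1, p, q, hp, hq, h => by
    obtain ⟨t, f, h0, htop⟩ :=
      exists_angles_of_orthogonal (coeff_mul_conj_coeff_add_eq_zero hp hq h)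
    set e := Complex.exp (Complex.I * f / 2) with he
    set e' := Complex.exp (-(Complex.I * f / 2)) with he'
    have hee : e * e' = 1 := exp_mul_exp_neg_eq_one _
    have hce : (starRingEnd ℂ) e = e' := conj_exp_I_mul f
    have hce' : (starRingEnd ℂ) e' = e := by rw [← hce, Complex.conj_conj]
    set s : ℂ := (Real.sin (t / 2) : ℂ) with hs
    set k : ℂ := (Real.cos (t / 2) : ℂ) with hk
    have hcs : (starRingEnd ℂ) s = s := Complex.conj_ofReal _
    have hck : (starRingEnd ℂ) k = k := Complex.conj_ofReal _
    have hsk : s ^ 2 + k ^ 2 = 1 := by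
      rw [hs, hk]; exact_mod_cast Real.sin_sq_add_cos_sq (t / 2)
    set P : ℂ[X] := p * C (k * e) - q * C (s * e') with hP
    set Q : ℂ[X] := p * C (s * e) + q * C (k * e') with hQ
    have hQX := divX_mul_X_add Q
    have hQ0 : Q.coeff 0 = 0 := by simpa only [hQ, coeff_add, coeff_mul_C] using h0
    rw [hQ0, C_0, add_zero] at hQX
    have hPdeg : P.natDegree ≤ n := by
      rw [natDegree_le_iff_coeff_eq_zero]
      intro N hN
      rcases eq_or_lt_of_le (show n + 1 ≤ N by omega) with h1 | h1
      · rw [← h1]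
        simpa only [hP, coeff_sub, coeff_mul_C] using htop
      · rw [hP, coeff_sub, coeff_mul_C, coeff_mul_C, coeff_eq_zero_of_natDegree_lt (by omega),
          coeff_eq_zero_of_natDegree_lt (p := q) (by omega)]
        simp
    have hQdeg : Q.divX.natDegree ≤ n := by
      have h1 : Q.natDegree ≤ n + 1 :=
        (natDegree_add_le _ _).trans (max_le ((natDegree_mul_C_le _ _).trans hp)
          ((natDegree_mul_C_le _ _).trans hq))
      rw [natDegree_divX_eq_natDegree_tsub_one]
      omega
    have hPz : ∀ z, P.eval z = p.eval z * (k * e) - q.eval z * (s * e') := by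
      intro z; simp only [hP, eval_sub, eval_mul, eval_C]
    have hQz : ∀ z, Q.divX.eval z * z = p.eval z * (s * e) + q.eval z * (k * e') := by
      intro z
      have := congrArg (eval z) hQX
      rw [eval_mul, eval_X] at this
      rw [this]; simp only [hQ, eval_add, eval_mul, eval_C]
    obtain ⟨ω, θ, φ, hW⟩ := exists_Wqsp_eq n hPdeg hQdeg (fun z hz => by
      have h1 : Q.divX.eval z * (starRingEnd ℂ) (Q.divX.eval z) =
          (Q.divX.eval z * z) * (starRingEnd ℂ) (Q.divX.eval z * z) := by
        rw [map_mul]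
        linear_combination (-(Q.divX.eval z * (starRingEnd ℂ) (Q.divX.eval z))) *
          mul_conj_of_norm_eq_one hz
      rw [h1, hPz, hQz, ← h z hz]
      simp only [map_mul, map_add, map_sub, hce, hce', hcs, hck]
      set a := p.eval z
      set b := q.eval z
      linear_combination (a * (starRingEnd ℂ) a + b * (starRingEnd ℂ) b) *
        (hsk + (s ^ 2 + k ^ 2) * hee))
    refine ⟨ω, Function.update θ (n + 1) t, Function.update φ (n + 1) f, fun x => ?_⟩
    obtain ⟨hW0, hW1⟩ := hW x
    have hcongr : Wqsp n ω (Function.update θ (n + 1) t) (Function.update φ (n + 1) f) x =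
        Wqsp n ω θ φ x :=
      Wqsp_congr (fun l hl => Function.update_of_ne (by omega) _ _)
        (fun l hl => Function.update_of_ne (by omega) _ _) x
    rw [Wqsp_succ, hcongr, Function.update_self, Function.update_self]
    set w := Complex.exp (-(Complex.I * x / 2)) with hw
    set z := Complex.exp (Complex.I * x) with hz
    have hwz : Complex.exp (Complex.I * x / 2) = w * z := by
      rw [hw, hz, ← Complex.exp_add]; congr 1; ring
    have hA : Rz x * Ry t * Rz f = !![w * k * e', -(w * s * e); w * z * s * e', w * z * k * e] := by
      simp only [Rz, Ry, hwz, ← hw, ← he, ← he', ← hs, ← hk]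
      ext i j
      fin_cases i <;> fin_cases j <;> simp [Matrix.mul_apply, Fin.sum_univ_two]
    rw [hA]
    simp only [Matrix.mul_apply, Fin.sum_univ_two, hW0, hW1]
    simp only [Matrix.of_apply, Matrix.cons_val_zero, Matrix.cons_val_one, Matrix.cons_val',
      Matrix.cons_val_fin_one]
    have hp' : P.eval z * (k * e') + (Q.divX.eval z * z) * (s * e') = p.eval z := by
      rw [hPz, hQz]
      linear_combination p.eval z * (hsk + (s ^ 2 + k ^ 2) * hee)
    have hq' : -(P.eval z * (s * e)) + (Q.divX.eval z * z) * (k * e) = q.eval z := by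
      rw [hPz, hQz]
      linear_combination q.eval z * (hsk + (s ^ 2 + k ^ 2) * hee)
    constructor
    · rw [← hp']; ring
    · rw [← hq']; ring

theorem exp_half_sq (x : ℝ) (m : ℕ) :
    Complex.exp (-(Complex.I * x / 2)) ^ (2 * m) * Complex.exp (Complex.I * x) ^ m = 1 := by
  rw [pow_mul, ← mul_pow, ← Complex.exp_nat_mul, ← Complex.exp_add]
  rw [show ((2 : ℕ) : ℂ) * -(Complex.I * x / 2) + Complex.I * x = 0 by push_cast; ring]
  simp

/-- Trigonometric QSP realizes every bounded trigonometric polynomial. -/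
theorem exists_Wqsp_eq_trigPoly (L : ℕ) (c : ℤ → ℂ) (F : ℝ → ℂ)
    (hF : ∀ x : ℝ, F x =
      ∑ j ∈ Finset.Icc (-(L : ℤ)) (L : ℤ), c j * Complex.exp (Complex.I * j * x))
    (hbound : ∀ x : ℝ, ‖F x‖ ≤ 1) :
    ∃ (ω : ℝ) (θ φ : ℕ → ℝ), ∀ x : ℝ, Wqsp (2 * L) ω θ φ x 0 0 = F x := by
  set p : ℂ[X] := ∑ j ∈ Finset.Icc (-(L : ℤ)) (L : ℤ), C (c j) * X ^ (j + L).toNat with hp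
  have hpF : ∀ x : ℝ, p.eval (Complex.exp (Complex.I * x)) =
      Complex.exp (Complex.I * x) ^ L * F x := by
    intro x
    rw [hF, hp, eval_finsetSum, Finset.mul_sum]
    refine Finset.sum_congr rfl fun j hj => ?_
    rw [Finset.mem_Icc] at hj
    have h1 : (((j + L).toNat : ℕ) : ℂ) = (j : ℂ) + L := by
      exact_mod_cast congrArg (Int.cast (R := ℂ)) (Int.toNat_of_nonneg (show 0 ≤ j + L by omega))
    rw [eval_mul, eval_C, eval_pow, eval_X, ← Complex.exp_nat_mul, ← Complex.exp_nat_mul, h1]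
    have h2 : Complex.exp ((j + L) * (Complex.I * x)) =
        Complex.exp (L * (Complex.I * x)) * Complex.exp (Complex.I * j * x) := by
      rw [← Complex.exp_add]; congr 1; ring
    rw [h2]
    ring
  have hdeg : p.natDegree ≤ 2 * L := by
    refine natDegree_sum_le_of_forall_le _ _ fun j hj => ?_
    rw [Finset.mem_Icc] at hj
    exact (natDegree_C_mul_X_pow_le _ _).trans (by omega)
  have hpb : ∀ z : ℂ, ‖z‖ = 1 → ‖p.eval z‖ ≤ 1 := by
    intro z hz
    have h1 : z = Complex.exp (Complex.I * z.arg) := by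
      have := Complex.norm_mul_exp_arg_mul_I z
      rw [hz, Complex.ofReal_one, one_mul, mul_comm] at this
      exact this.symm
    have h2 := hpF z.arg
    rw [← h1] at h2
    rw [h2, norm_mul, norm_pow, hz, one_pow, one_mul]
    exact hbound _
  obtain ⟨q, hq, hpq⟩ := exists_completion hdeg hpb
  obtain ⟨ω, θ, φ, hW⟩ := exists_Wqsp_eq (2 * L) hdeg hq hpq
  refine ⟨ω, θ, φ, fun x => ?_⟩
  rw [(hW x).1, hpF, ← mul_assoc, exp_half_sq, one_mul]

end

/-- The isometry `v ↦ v ⊗ u` of the ancilla into the full space. -/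
def ancillaTensor {n : Type*} (u : n → ℂ) : Matrix (Fin 2 × n) (Fin 2) ℂ :=
  Matrix.of fun a b => (1 : Matrix (Fin 2) (Fin 2) ℂ) a.1 b * u a.2

theorem kronecker_mul_ancillaTensor {n : Type*} [Fintype n]
    (M : Matrix (Fin 2) (Fin 2) ℂ) {X : Matrix n n ℂ}
    {u : n → ℂ} {a : ℂ} (hX : X.mulVec u = a • u) :
    (M ⊗ₖ X) * ancillaTensor u = ancillaTensor u * (a • M) := by
  ext ⟨i, k⟩ b
  have h1 : ∑ j, X k j * u j = a * u k := congrFun hX k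
  simp only [Matrix.mul_apply, Fintype.sum_prod_type, ancillaTensor, Matrix.of_apply,
    Matrix.kroneckerMap_apply, Matrix.smul_apply, smul_eq_mul]
  have h2 : ∀ l, ∑ j, M i l * X k j * ((1 : Matrix (Fin 2) (Fin 2) ℂ) l b * u j) =
      M i l * (1 : Matrix (Fin 2) (Fin 2) ℂ) l b * (a * u k) := by
    intro l
    rw [← h1, Finset.mul_sum]
    exact Finset.sum_congr rfl fun j _ => by ring
  simp only [h2]
  simp only [Matrix.one_apply, mul_ite, ite_mul, mul_one, mul_zero, one_mul, zero_mul,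
    Finset.sum_ite_eq, Finset.sum_ite_eq', Finset.mem_univ, if_true]
  ring

theorem blockDiag2_mul_ancillaTensor {n : Type*} [Fintype n] [DecidableEq n]
    {X Y : Matrix n n ℂ} {u : n → ℂ} {a b : ℂ}
    (hX : X.mulVec u = a • u) (hY : Y.mulVec u = b • u) :
    blockDiag2 X Y * ancillaTensor u = ancillaTensor u * !![a, 0; 0, b] := by
  rw [blockDiag2, Matrix.add_mul, kronecker_mul_ancillaTensor _ hX,
    kronecker_mul_ancillaTensor _ hY, ← Matrix.mul_add]
  congr 1
  ext i j
  fin_cases i <;> fin_cases j <;> simp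

theorem mul_mul_ancillaTensor {n : Type*} [Fintype n]
    {A B : Matrix (Fin 2 × n) (Fin 2 × n) ℂ} {u : n → ℂ}
    {A' B' : Matrix (Fin 2) (Fin 2) ℂ} (hA : A * ancillaTensor u = ancillaTensor u * A')
    (hB : B * ancillaTensor u = ancillaTensor u * B') :
    A * B * ancillaTensor u = ancillaTensor u * (A' * B') := by
  rw [Matrix.mul_assoc, hB, ← Matrix.mul_assoc, hA, Matrix.mul_assoc]

theorem qppEven_mul_ancillaTensor {n : Type*} [Fintype n] [DecidableEq n]
    {U : Matrix n n ℂ} {u : n → ℂ} {t : ℝ}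
    (hu : U.mulVec u = Complex.exp (Complex.I * t) • u)
    (hu' : Uᴴ.mulVec u = Complex.exp (-(Complex.I * t)) • u) (m : ℕ) (ω : ℝ) (θ φ : ℕ → ℝ) :
    qppEven U m ω θ φ * ancillaTensor u = ancillaTensor u * Wqsp (2 * m) ω θ φ t := by
  have hone : (1 : Matrix n n ℂ).mulVec u = (1 : ℂ) • u := by simp
  have hkron : ∀ M : Matrix (Fin 2) (Fin 2) ℂ,
      (M ⊗ₖ (1 : Matrix n n ℂ)) * ancillaTensor u = ancillaTensor u * M := by
    intro M
    simpa using kronecker_mul_ancillaTensor M hone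
  induction m with
  | zero => simpa [qppEven, Wqsp] using hkron _
  | succ m ih =>
    have hsucc : qppEven U (m + 1) ω θ φ = qppEven U m ω θ φ *
        (blockDiag2 Uᴴ 1 *
          ((Ry (θ (2 * m + 1)) * Rz (φ (2 * m + 1))) ⊗ₖ (1 : Matrix n n ℂ)) *
          blockDiag2 1 U *
          ((Ry (θ (2 * m + 2)) * Rz (φ (2 * m + 2))) ⊗ₖ (1 : Matrix n n ℂ))) := by
      simp [qppEven, List.range_succ, Matrix.mul_assoc]
    have h1 : (!![Complex.exp (-(Complex.I * t)), 0; 0, 1] : Matrix (Fin 2) (Fin 2) ℂ) =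
        Complex.exp (-(Complex.I * t / 2)) • Rz t := by
      ext i j
      fin_cases i <;> fin_cases j <;> simp [Rz, ← Complex.exp_add]
      congr 1; ring
    have h2 : (!![1, 0; 0, Complex.exp (Complex.I * t)] : Matrix (Fin 2) (Fin 2) ℂ) =
        Complex.exp (Complex.I * t / 2) • Rz t := by
      ext i j
      fin_cases i <;> fin_cases j <;> simp [Rz, ← Complex.exp_add]
    rw [hsucc, mul_mul_ancillaTensor ih (mul_mul_ancillaTensor (mul_mul_ancillaTensor
      (mul_mul_ancillaTensor (blockDiag2_mul_ancillaTensor hu' hone) (hkron _))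
      (blockDiag2_mul_ancillaTensor hone hu)) (hkron _)), h1, h2,
      show 2 * (m + 1) = 2 * m + 1 + 1 by ring, Wqsp_succ, Wqsp_succ]
    simp only [Matrix.smul_mul, Matrix.mul_smul, smul_smul, exp_mul_exp_neg_eq_one, one_smul,
      Matrix.mul_assoc]

/-- quantum phase evolution. There are QPP parameters such that the upper-left
`N×N` block of `V^{2L}(U)` equals `F(U) = Σ_j F(τ_j) χ_j χ_j†`. -/
theorem stmt_6 (N : ℕ) (U : Matrix (Fin N) (Fin N) ℂ)
    (hU : U ∈ Matrix.unitaryGroup (Fin N) ℂ)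
    (χ : Fin N → Fin N → ℂ) (τ : Fin N → ℝ)
    (horth : ∀ j k : Fin N,
      ∑ i, (starRingEnd ℂ) (χ j i) * χ k i = if j = k then 1 else 0)
    (heig : ∀ j : Fin N, U.mulVec (χ j) = Complex.exp (Complex.I * τ j) • χ j)
    (L : ℕ) (c : ℤ → ℂ) (F : ℝ → ℂ)
    (hF : ∀ x : ℝ, F x =
      ∑ j ∈ Finset.Icc (-(L : ℤ)) (L : ℤ), c j * Complex.exp (Complex.I * j * x))
    (hbound : ∀ x : ℝ, ‖F x‖ ≤ 1) :
    ∃ (ω : ℝ) (θ φ : ℕ → ℝ), ∀ i k : Fin N,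
      qpp U (2 * L) ω θ φ (0, i) (0, k) =
        ∑ j, F (τ j) * χ j i * (starRingEnd ℂ) (χ j k) := by
  obtain ⟨ω, θ, φ, hW⟩ := exists_Wqsp_eq_trigPoly L c F hF hbound
  refine ⟨ω, θ, φ, fun i k => ?_⟩
  have hUU : Uᴴ * U = 1 := Matrix.mem_unitaryGroup_iff'.mp hU
  have heig' : ∀ j, Uᴴ.mulVec (χ j) = Complex.exp (-(Complex.I * τ j)) • χ j := by
    intro j
    have h1 : Uᴴ.mulVec (U.mulVec (χ j)) = χ j := by
      rw [Matrix.mulVec_mulVec, hUU, Matrix.one_mulVec]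
    rw [heig, Matrix.mulVec_smul] at h1
    conv_rhs => rw [← h1]
    rw [smul_smul, mul_comm, exp_mul_exp_neg_eq_one, one_smul]
  have hcomplete : ∀ l k : Fin N,
      ∑ j, χ j l * (starRingEnd ℂ) (χ j k) = if l = k then 1 else 0 := by
    have h1 : (Matrix.of fun j i => (starRingEnd ℂ) (χ j i)) * (Matrix.of fun i j => χ j i) =
        (1 : Matrix (Fin N) (Fin N) ℂ) := by
      ext j k
      simpa [Matrix.mul_apply, Matrix.one_apply] using horth j k
    intro l k
    have h2 := mul_eq_one_comm.mp h1
    simpa [Matrix.mul_apply, Matrix.one_apply] using congrFun (congrFun h2 l) k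
  have hV : ∀ j l, ∑ m, qpp U (2 * L) ω θ φ (0, l) (0, m) * χ j m = F (τ j) * χ j l := by
    intro j l
    have h1 : qpp U (2 * L) ω θ φ = qppEven U L ω θ φ := by simp [qpp]
    have h2 := congrFun (congrFun
      (qppEven_mul_ancillaTensor (heig j) (heig' j) L ω θ φ) (0, l)) 0
    rw [h1, ← hW]
    simpa [Matrix.mul_apply, ancillaTensor, Fintype.sum_prod_type, mul_comm] using h2
  calc qpp U (2 * L) ω θ φ (0, i) (0, k)
      = ∑ m, qpp U (2 * L) ω θ φ (0, i) (0, m) * ∑ j, χ j m * (starRingEnd ℂ) (χ j k) := by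
        simp [hcomplete]
    _ = ∑ j, (∑ m, qpp U (2 * L) ω θ φ (0, i) (0, m) * χ j m) * (starRingEnd ℂ) (χ j k) := by
        simp only [Finset.mul_sum, Finset.sum_mul]
        rw [Finset.sum_comm]
        exact Finset.sum_congr rfl fun j _ => Finset.sum_congr rfl fun m _ => by ring
    _ = ∑ j, F (τ j) * χ j i * (starRingEnd ℂ) (χ j k) := by simp only [hV]
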